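/- Assume moreover that a1 = 1 (so a2 ≥ 5). Then for every μ ∈ P, the Weyl group orbit Wμ satisfies Wμ ∩ (P+ ∪ (−P+)) = ∅ if and only if Wμ contains an element λ = k1Λ1 − k2Λ2 with k1, k2 ∈ ℤ>0 such that 2k1 ≤ k2 ≤ (a2−2)k1. -/

import Mathlib

namespace HypWeyl

/-- the simple reflection `s1` on `P = ℤΛ1 ⊕ ℤΛ2`, in `(Λ1, Λ2)`-coordinates:
`s1(μ) = μ − ⟨μ, α1^∨⟩ α1` with `α1 = (2, −a2)`. -/
def s1 (a2 : ℤ) (μ : ℤ × ℤ) : ℤ × ℤ := (-μ.1, μ.2 + a2 * μ.1)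

/-- the simple reflection `s2`: `s2(μ) = μ − ⟨μ, α2^∨⟩ α2` with `α2 = (−a1, 2)`. -/
def s2 (a1 : ℤ) (μ : ℤ × ℤ) : ℤ × ℤ := (μ.1 + a1 * μ.2, -μ.2)

def refl (a1 a2 : ℤ) (b : Bool) : ℤ × ℤ → ℤ × ℤ := if b then s1 a2 else s2 a1

/-- the Weyl group orbit `Wμ` (the generators `s1, s2` are involutions, so the
group generated by them coincides with the monoid generated by them). -/
def orbit (a1 a2 : ℤ) (μ : ℤ × ℤ) : Set (ℤ × ℤ) :=
  {ν | ∃ l : List Bool, ν = l.foldl (fun w b => refl a1 a2 b w) μ}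

/-- the set `P+` of dominant integral weights. -/
def Pplus : Set (ℤ × ℤ) := {ν | 0 ≤ ν.1 ∧ 0 ≤ ν.2}

end HypWeyl

namespace HypWeyl

theorem self_mem_orbit (a1 a2 : ℤ) (μ : ℤ × ℤ) : μ ∈ orbit a1 a2 μ := ⟨[], rfl⟩

theorem refl_mem_orbit {a1 a2 : ℤ} {μ ν : ℤ × ℤ} (b : Bool) (h : ν ∈ orbit a1 a2 μ) :
    refl a1 a2 b ν ∈ orbit a1 a2 μ := by
  obtain ⟨l, rfl⟩ := h
  exact ⟨l ++ [b], by simp⟩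

theorem s1_mem_orbit {a1 a2 x y : ℤ} {μ : ℤ × ℤ} (h : (x, y) ∈ orbit a1 a2 μ) :
    (-x, y + a2 * x) ∈ orbit a1 a2 μ := by
  simpa [refl, s1] using refl_mem_orbit true h

theorem s2_mem_orbit {a1 a2 x y : ℤ} {μ : ℤ × ℤ} (h : (x, y) ∈ orbit a1 a2 μ) :
    (x + a1 * y, -y) ∈ orbit a1 a2 μ := by
  simpa [refl, s2] using refl_mem_orbit false h

/-- The Weyl-invariant quadratic form on `P`, up to scaling. -/
def quadForm (a1 a2 : ℤ) (μ : ℤ × ℤ) : ℤ :=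
  a2 * μ.1 ^ 2 + a1 * a2 * μ.1 * μ.2 + a1 * μ.2 ^ 2

theorem quadForm_refl (a1 a2 : ℤ) (b : Bool) (μ : ℤ × ℤ) :
    quadForm a1 a2 (refl a1 a2 b μ) = quadForm a1 a2 μ := by
  cases b <;> simp [refl, s1, s2, quadForm] <;> ring

theorem quadForm_eq_of_mem_orbit {a1 a2 : ℤ} {μ ν : ℤ × ℤ} (h : ν ∈ orbit a1 a2 μ) :
    quadForm a1 a2 ν = quadForm a1 a2 μ := by
  obtain ⟨l, rfl⟩ := h
  induction l generalizing μ with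
  | nil => rfl
  | cons b l ih => rw [List.foldl_cons, ih, quadForm_refl]

theorem quadForm_nonneg {a1 a2 : ℤ} (h1 : 0 ≤ a1) (h2 : 0 ≤ a2) {ν : ℤ × ℤ}
    (h : ν ∈ Pplus ∨ -ν ∈ Pplus) : 0 ≤ quadForm a1 a2 ν := by
  have hxy : 0 ≤ ν.1 * ν.2 := by
    rcases h with ⟨hx, hy⟩ | ⟨hx, hy⟩
    · exact mul_nonneg hx hy
    · simp only [Prod.fst_neg, Prod.snd_neg] at hx hy
      nlinarith
  have hcross : 0 ≤ a1 * a2 * (ν.1 * ν.2) := by positivity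
  have hsq : 0 ≤ a2 * ν.1 ^ 2 + a1 * ν.2 ^ 2 := by positivity
  unfold quadForm
  linarith

theorem quadForm_neg {a k l : ℤ} (ha : 4 < a) (hk : 0 < k) (h1 : 2 * k ≤ l)
    (h2 : l ≤ (a - 2) * k) : quadForm 1 a (k, -l) < 0 := by
  have hprod : 0 ≤ (l - 2 * k) * ((a - 2) * k - l) :=
    mul_nonneg (by linarith) (by linarith)
  have hpos : 0 < (a - 4) * k ^ 2 := mul_pos (by linarith) (by positivity)
  simp only [quadForm]
  linarith

theorem exists_natAbs_fst_minimal (a1 a2 : ℤ) (μ : ℤ × ℤ) :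
    ∃ ν ∈ orbit a1 a2 μ, ∀ ξ ∈ orbit a1 a2 μ, ν.1.natAbs ≤ ξ.1.natAbs := by
  obtain ⟨ν, hν, hmin⟩ := WellFounded.has_min
    (measure fun ν : ℤ × ℤ => ν.1.natAbs).wf (orbit a1 a2 μ) ⟨μ, self_mem_orbit a1 a2 μ⟩
  exact ⟨ν, hν, fun ξ hξ => not_lt.mp (hmin ξ hξ)⟩

end HypWeyl

open HypWeyl in
theorem orbit_avoids_dominant_iff_of_a1_eq_one
    (a1 a2 : ℤ) (ha1 : a1 = 1) (ha2 : 1 ≤ a2) (ha : 4 < a1 * a2) (μ : ℤ × ℤ) :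
    (∀ ν ∈ orbit a1 a2 μ, ¬(ν ∈ Pplus ∨ -ν ∈ Pplus)) ↔
      ∃ k1 k2 : ℤ, 0 < k1 ∧ 0 < k2 ∧ (k1, -k2) ∈ orbit a1 a2 μ ∧
        (2 * k1 ≤ k2 ∧ k2 ≤ (a2 - 2) * k1) := by
  subst ha1
  constructor
  · intro h
    have hsign : ∀ x y : ℤ, (x, y) ∈ orbit 1 a2 μ → (0 < x ∧ y < 0) ∨ (x < 0 ∧ 0 < y) := by
      intro x y hxy
      have hne := h _ hxy
      simp only [Pplus, Set.mem_ofPred_eq, Prod.fst_neg, Prod.snd_neg] at hne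
      omega
    obtain ⟨k, l, hk, hmem, hmin⟩ : ∃ k l : ℤ, 0 < k ∧ (k, -l) ∈ orbit 1 a2 μ ∧
        ∀ ξ ∈ orbit 1 a2 μ, k.natAbs ≤ ξ.1.natAbs := by
      obtain ⟨⟨x, y⟩, hν, hmin⟩ := exists_natAbs_fst_minimal 1 a2 μ
      rcases hsign x y hν with hx | hx
      · exact ⟨x, -y, hx.1, by simpa using hν, hmin⟩
      · exact ⟨-x, -(y + a2 * x), by omega, by simpa using s1_mem_orbit hν,
          by simpa using hmin⟩
    have h2 := s2_mem_orbit hmem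
    have h1 := s1_mem_orbit hmem
    have h12 := s2_mem_orbit h1
    have m2 := hmin _ h2
    have m12 := hmin _ h12
    have g := hsign _ _ hmem
    have g2 := hsign _ _ h2
    have g1 := hsign _ _ h1
    have g12 := hsign _ _ h12
    simp only [one_mul] at m2 m12 g2 g12
    refine ⟨k, l, hk, by omega, hmem, by omega, ?_⟩
    rw [sub_mul]
    omega
  · rintro ⟨k, l, hk, -, hmem, h1, h2⟩ ν hν hdom
    have hneg := quadForm_neg (by linarith) hk h1 h2
    rw [quadForm_eq_of_mem_orbit hmem, ← quadForm_eq_of_mem_orbit hν] at hneg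
    exact hneg.not_ge (quadForm_nonneg zero_le_one (by linarith) hdom)
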